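/- Let P and Q be probability measures on the real line with cumulative distribution functions F_Y and G_Y, let c be a real number, and let σ > 0. Let P_V and Q_V denote the pushforward measures of P and Q under the map y ↦ |y − c|/σ, with cumulative distribution functions F_V and G_V. Then sup_{v ∈ ℝ} |F_V(v) − G_V(v)| ≤ 2 · sup_{y ∈ ℝ} |F_Y(y) − G_Y(y)|. -/

import Mathlib

open MeasureTheory

theorem bddAbove_abs_real_sub_real {α ι : Type*} [MeasurableSpace α] (P Q : Measure α)
    [IsProbabilityMeasure P] [IsProbabilityMeasure Q] (s : ι → Set α) :
    BddAbove (Set.range fun i => |P.real (s i) - Q.real (s i)|) := by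
  refine ⟨1, ?_⟩
  rintro _ ⟨i, rfl⟩
  exact abs_sub_le_of_nonneg_of_le measureReal_nonneg measureReal_le_one
    measureReal_nonneg measureReal_le_one

theorem tendsto_measureReal_Iic_Iio (P : Measure ℝ) [IsFiniteMeasure P] {u : ℕ → ℝ} {a : ℝ}
    (hu : Monotone u) (hlt : ∀ n, u n < a) (hlim : Filter.Tendsto u Filter.atTop (nhds a)) :
    Filter.Tendsto (fun n => P.real (Set.Iic (u n))) Filter.atTop
      (nhds (P.real (Set.Iio a))) := by
  rw [← iUnion_Iic_eq_Iio_of_lt_of_tendsto hlt hlim]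
  exact (ENNReal.tendsto_toReal (measure_ne_top _ _)).comp
    (tendsto_measure_iUnion_atTop fun _ _ h => Set.Iic_subset_Iic.2 (hu h))

theorem abs_measureReal_Iio_sub_le (P Q : Measure ℝ) [IsFiniteMeasure P] [IsFiniteMeasure Q]
    {K : ℝ} (hK : ∀ y, |P.real (Set.Iic y) - Q.real (Set.Iic y)| ≤ K) (a : ℝ) :
    |P.real (Set.Iio a) - Q.real (Set.Iio a)| ≤ K := by
  obtain ⟨u, hu, hlt, hlim⟩ := exists_seq_strictMono_tendsto a
  exact le_of_tendsto ((tendsto_measureReal_Iic_Iio P hu.monotone hlt hlim).sub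
    (tendsto_measureReal_Iic_Iio Q hu.monotone hlt hlim)).abs
    (Filter.Eventually.of_forall fun n => hK (u n))

theorem measureReal_Icc_eq_sub (P : Measure ℝ) [IsFiniteMeasure P] {a b : ℝ} (hab : a ≤ b) :
    P.real (Set.Icc a b) = P.real (Set.Iic b) - P.real (Set.Iio a) := by
  rw [← measureReal_sdiff (Set.Iio_subset_Iic hab) measurableSet_Iio]
  congr 1
  ext x
  simp

theorem preimage_abs_sub_div_Iic (c v : ℝ) {σ : ℝ} (hσ : 0 < σ) :
    (fun y : ℝ => |y - c| / σ) ⁻¹' Set.Iic v = Set.Icc (c - v * σ) (c + v * σ) := by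
  ext y
  simp only [Set.mem_preimage, Set.mem_Iic, Set.mem_Icc, div_le_iff₀ hσ, abs_le]
  constructor <;> rintro ⟨h₁, h₂⟩ <;> constructor <;> linarith

/-- The Kolmogorov–Smirnov distance between the pushforwards of two probability
measures on `ℝ` under the normalized score map `y ↦ |y - c| / σ` (with `σ > 0`) is at most
twice the KS distance between the original measures. -/
theorem ks_normalized_pushforward (P Q : Measure ℝ)
    [IsProbabilityMeasure P] [IsProbabilityMeasure Q] (c σ : ℝ) (hσ : 0 < σ) :
    (⨆ v : ℝ, |((P.map (fun y => |y - c| / σ)) (Set.Iic v)).toReal -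
        ((Q.map (fun y => |y - c| / σ)) (Set.Iic v)).toReal|)
      ≤ 2 * ⨆ y : ℝ, |(P (Set.Iic y)).toReal - (Q (Set.Iic y)).toReal| := by
  simp only [← measureReal_def]
  set K := ⨆ y : ℝ, |P.real (Set.Iic y) - Q.real (Set.Iic y)|
  have hK : ∀ y, |P.real (Set.Iic y) - Q.real (Set.Iic y)| ≤ K :=
    le_ciSup (bddAbove_abs_real_sub_real P Q Set.Iic)
  have hmeas : Measurable fun y : ℝ => |y - c| / σ := by fun_prop
  refine ciSup_le fun v => ?_
  rw [map_measureReal_apply hmeas measurableSet_Iic, map_measureReal_apply hmeas measurableSet_Iic,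
    preimage_abs_sub_div_Iic c v hσ]
  rcases lt_or_ge v 0 with hv | hv
  · have hneg : v * σ < 0 := mul_neg_of_neg_of_pos hv hσ
    rw [Set.Icc_eq_empty (by linarith)]
    simpa using (abs_nonneg _).trans (hK 0)
  · have hpos : 0 ≤ v * σ := mul_nonneg hv hσ.le
    rw [measureReal_Icc_eq_sub P (by linarith), measureReal_Icc_eq_sub Q (by linarith),
      sub_sub_sub_comm, two_mul]
    exact (abs_sub _ _).trans (add_le_add (hK _) (abs_measureReal_Iio_sub_le P Q hK _))
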